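/- arXiv:2509.10013 — 2 statements merged into one kernel-verified Lean document; each statement's English description precedes it below -/
import Mathlib

section
/- Let A ∈ ℂ and let C ∈ ℂ satisfy C² = −Y₁(A)Y₂(A). Define φ(z) = (iC + (1/2)Φ_e'(z;A)) / Φ_e(z;A). Then φ satisfies the Riccati equation φ'(z) = q(z;A) − φ(z)² at every z ∈ ℂ ∖ S with Φ_e(z;A) ≠ 0. -/
open Complex Filter Topology

noncomputable section

/-- The lattice `Λ_τ = ℤ + τℤ`. -/
def Lam (τ : ℂ) : Set ℂ := {ω | ∃ m n : ℤ, ω = (m : ℂ) + (n : ℂ) * τ}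

/-- The nonzero lattice points. -/
def Lam' (τ : ℂ) : Set ℂ := {ω | ω ∈ Lam τ ∧ ω ≠ 0}

/-- The Weierstrass elliptic function `℘(z; τ)`. -/
def wp (τ z : ℂ) : ℂ :=
  1 / z ^ 2 + ∑' ω : Lam' τ, (1 / (z - (ω : ℂ)) ^ 2 - 1 / (ω : ℂ) ^ 2)

/-- The Weierstrass zeta function `ζ(z; τ)`. -/
def wzeta (τ z : ℂ) : ℂ :=
  1 / z + ∑' ω : Lam' τ, (1 / (z - (ω : ℂ)) + 1 / (ω : ℂ) + z / (ω : ℂ) ^ 2)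

/-- The Weierstrass sigma function `σ(z; τ)`. -/
def wsigma (τ z : ℂ) : ℂ :=
  z * ∏' ω : Lam' τ,
    ((1 - z / (ω : ℂ)) * Complex.exp (z / (ω : ℂ) + z ^ 2 / (2 * (ω : ℂ) ^ 2)))

/-- `℘'(z; τ)`. -/
def wpd (τ : ℂ) : ℂ → ℂ := deriv (wp τ)

/-- `℘''(z; τ)`. -/
def wpdd (τ : ℂ) : ℂ → ℂ := deriv (deriv (wp τ))

/-- The constant `B(A)`. -/
def Bc (τ p A : ℂ) : ℂ :=
  A ^ 2 - wzeta τ (2 * p) * A - 3 / 4 * wp τ (2 * p) - 2 * wp τ p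

/-- The potential `q(z; A)`. -/
def qpot (τ p A z : ℂ) : ℂ :=
  2 * wp τ z + 3 / 4 * (wp τ (z + p) + wp τ (z - p))
    + A * (wzeta τ (z + p) - wzeta τ (z - p)) + Bc τ p A

/-- The singular set `S = Λ_τ ∪ (p + Λ_τ) ∪ (−p + Λ_τ)`. -/
def Sset (τ p : ℂ) : Set ℂ :=
  Lam τ ∪ {z | z - p ∈ Lam τ} ∪ {z | z + p ∈ Lam τ}

/-- The unique elliptic solution `Φ_e(z; A)` of the second symmetric product equation. -/
def Phie (τ p A z : ℂ) : ℂ :=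
  wp τ z + (A / 2 - 3 * wpdd τ p / (8 * wpd τ p)) * (wzeta τ (z + p) - wzeta τ (z - p))
    - A ^ 2 + (wpdd τ p / (2 * wpd τ p) - wzeta τ p) * A
    - wp τ p + 3 / 4 * (wpdd τ p / wpd τ p) * wzeta τ p
    + 3 / 16 * (wpdd τ p ^ 2 / wpd τ p ^ 2)

/-- The cubic factor `Y₁(A)`. -/
def Y1 (τ p A : ℂ) : ℂ :=
  A ^ 3 - 5 * wpdd τ p / (4 * wpd τ p) * A ^ 2
    + 3 * (wp τ p + wpdd τ p ^ 2 / (16 * wpd τ p ^ 2)) * A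
    + wpd τ p / 2 - 9 * wpdd τ p / (4 * wpd τ p) * wp τ p
    + 9 / 64 * (wpdd τ p ^ 3 / wpd τ p ^ 3)

/-- The cubic factor `Y₂(A)`. -/
def Y2 (τ p A : ℂ) : ℂ :=
  A ^ 3 - wpdd τ p / (4 * wpd τ p) * A ^ 2
    - 5 / 16 * (wpdd τ p ^ 2 / wpd τ p ^ 2) * A
    + 2 * wpd τ p - 3 / 64 * (wpdd τ p ^ 3 / wpd τ p ^ 3)

/-- The function `φ(P; z) = (iC + Φ_e'(z;A)/2)/Φ_e(z;A)`. -/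
def phiBA (τ p A C z : ℂ) : ℂ :=
  (Complex.I * C + 1 / 2 * deriv (Phie τ p A) z) / Phie τ p A z


namespace PeriodPair

variable (L : PeriodPair)

/-- The regular part at the origin of the Weierstrass zeta function of a period pair. -/
def weierstrassZetaExcept (z : ℂ) : ℂ :=
  ∑' l : L.lattice, if (l : ℂ) = 0 then 0 else (1 / (z - l) + 1 / l + z / (l : ℂ) ^ 2)

/-- The Weierstrass zeta function of a period pair. -/
def weierstrassZeta (z : ℂ) : ℂ := 1 / z + L.weierstrassZetaExcept z

theorem weierstrassZeta_bound (r : ℝ) (hr : 0 < r) (z : ℂ) (hz : ‖z‖ < r) (l : ℂ)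
    (h : 2 * r ≤ ‖l‖) :
    ‖1 / (z - l) + 1 / l + z / l ^ 2‖ ≤ 2 * r ^ 2 * ‖l‖ ^ (-3 : ℝ) := by
  have hl : 0 < ‖l‖ := by linarith
  have hl0 : l ≠ 0 := norm_pos_iff.mp hl
  have hzl : ‖l‖ / 2 ≤ ‖z - l‖ := by
    rw [norm_sub_rev]
    exact le_trans (by linarith) (norm_sub_norm_le l z)
  have hzl0 : z - l ≠ 0 := norm_pos_iff.mp (by linarith)
  have e : 1 / (z - l) + 1 / l + z / l ^ 2 = z ^ 2 / ((z - l) * l ^ 2) := by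
    field_simp
    ring
  rw [e, norm_div, norm_mul, norm_pow, norm_pow]
  calc ‖z‖ ^ 2 / (‖z - l‖ * ‖l‖ ^ 2) ≤ r ^ 2 / (‖l‖ / 2 * ‖l‖ ^ 2) := by gcongr
    _ = 2 * r ^ 2 / ‖l‖ ^ 3 := by field
    _ = _ := by norm_cast

theorem hasSumLocallyUniformly_weierstrassZetaExcept :
    HasSumLocallyUniformly
      (fun (l : L.lattice) (z : ℂ) ↦
        if (l : ℂ) = 0 then 0 else (1 / (z - l) + 1 / l + z / (l : ℂ) ^ 2))
      L.weierstrassZetaExcept := by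
  refine L.hasSumLocallyUniformly_aux (u := (2 * · ^ 2 * ‖·‖ ^ (-3 : ℝ))) _
    (fun _ _ ↦ (ZLattice.summable_norm_rpow _ _ (by simp; norm_num)).mul_left _) fun r hr ↦
    Filter.eventually_atTop.mpr ⟨2 * r, ?_⟩
  rintro _ h s hs l rfl
  split_ifs
  · simpa using! show 0 ≤ 2 * r ^ 2 * (‖(l : ℂ)‖ ^ 3)⁻¹ by positivity
  · exact weierstrassZeta_bound r hr s hs l h

theorem sub_ne_zero_of_notMem_lattice_sdiff {z : ℂ} (hz : z ∈ ((L.lattice : Set ℂ) \ {0})ᶜ)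
    (l : L.lattice) (hl : (l : ℂ) ≠ 0) : z - l ≠ 0 := by
  intro e
  obtain rfl := sub_eq_zero.mp e
  exact hz ⟨l.2, hl⟩

theorem hasDerivAt_weierstrassZetaExcept {z : ℂ} (hz : z ∈ ((L.lattice : Set ℂ) \ {0})ᶜ) :
    HasDerivAt L.weierstrassZetaExcept (-L.weierstrassPExcept 0 z) z := by
  have hterm (l : L.lattice) (w : ℂ) (hw : w ∈ ((L.lattice : Set ℂ) \ {0})ᶜ) :
      HasDerivAt (fun w : ℂ ↦ if (l : ℂ) = 0 then 0 else (1 / (w - l) + 1 / l + w / (l : ℂ) ^ 2))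
        (-(if (l : ℂ) = 0 then 0 else (1 / (w - l) ^ 2 - 1 / (l : ℂ) ^ 2))) w := by
    split_ifs with hl
    · simpa using hasDerivAt_const w (0 : ℂ)
    · have hne := L.sub_ne_zero_of_notMem_lattice_sdiff hw l hl
      have h1 : HasDerivAt (fun w : ℂ ↦ w - l) 1 w := (hasDerivAt_id w).sub_const _
      have h2 := (((hasDerivAt_const w (1 : ℂ)).fun_div h1 hne).add_const (1 / (l : ℂ))).fun_add
        ((hasDerivAt_id w).div_const ((l : ℂ) ^ 2))
      refine h2.congr_deriv ?_
      field_simp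
      ring
  have hfin (s : Finset L.lattice) (w : ℂ) (hw : w ∈ ((L.lattice : Set ℂ) \ {0})ᶜ) :=
    HasDerivAt.fun_sum (u := s) fun l _ ↦ hterm l w hw
  have hopen := L.isOpen_compl_lattice_sdiff (s := {0})
  have hlim := L.hasSumLocallyUniformly_weierstrassZetaExcept.tendstoLocallyUniformlyOn
    (s := ((L.lattice : Set ℂ) \ {0})ᶜ)
  have hd : DifferentiableOn ℂ L.weierstrassZetaExcept ((L.lattice : Set ℂ) \ {0})ᶜ :=
    hlim.differentiableOn (.of_forall fun s w hw ↦
      (hfin s w hw).differentiableAt.differentiableWithinAt) hopen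
  have hval : deriv L.weierstrassZetaExcept z = -L.weierstrassPExcept 0 z := by
    have h1 := (hlim.deriv (.of_forall fun s w hw ↦
      (hfin s w hw).differentiableAt.differentiableWithinAt) hopen).tendsto_at hz
    have h2 := (L.hasSum_weierstrassPExcept 0 z).neg
    refine tendsto_nhds_unique h1 (Filter.Tendsto.congr (fun s ↦ ?_) h2)
    exact (hfin s z hz).deriv.symm
  rw [← hval]
  exact (hd.differentiableAt (hopen.mem_nhds hz)).hasDerivAt

@[simp] theorem weierstrassZetaExcept_zero : L.weierstrassZetaExcept 0 = 0 := by
  simp [weierstrassZetaExcept]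

@[simp] theorem weierstrassZeta_neg (z : ℂ) : L.weierstrassZeta (-z) = -L.weierstrassZeta z := by
  unfold weierstrassZeta weierstrassZetaExcept
  rw [← (Equiv.neg L.lattice).tsum_eq, neg_add, ← tsum_neg]
  congr 1
  · rw [div_neg]
  · congr with l
    by_cases hl : (l : ℂ) = 0
    · simp [hl]
    · have : (-z - -(l : ℂ)) = -(z - l) := by ring
      simp only [Equiv.neg_apply, NegMemClass.coe_neg, neg_eq_zero, hl, if_false, this, div_neg,
        neg_div, neg_sq]
      ring

theorem weierstrassP_eq_add_except (z : ℂ) :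
    L.weierstrassP z = 1 / z ^ 2 + L.weierstrassPExcept 0 z := by
  have := L.weierstrassPExcept_def 0 z
  simp only [ZeroMemClass.coe_zero, sub_zero] at this
  rw [this]
  simp

theorem derivWeierstrassP_eq_add_except (z : ℂ) :
    L.derivWeierstrassP z = -2 / z ^ 3 + L.derivWeierstrassPExcept 0 z := by
  have := L.derivWeierstrassPExcept_def 0 z
  simp only [ZeroMemClass.coe_zero, sub_zero] at this
  rw [this]
  ring

theorem hasDerivAt_weierstrassP {z : ℂ} (hz : z ∉ L.lattice) :
    HasDerivAt L.weierstrassP (L.derivWeierstrassP z) z := by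
  rw [← L.deriv_weierstrassP]
  exact (L.analyticOnNhd_weierstrassP z hz).differentiableAt.hasDerivAt

theorem hasDerivAt_weierstrassZeta {z : ℂ} (hz : z ∉ L.lattice) :
    HasDerivAt L.weierstrassZeta (-L.weierstrassP z) z := by
  have hz0 : z ≠ 0 := fun h ↦ hz (h ▸ zero_mem _)
  have h1 := (hasDerivAt_inv hz0).fun_add
    (L.hasDerivAt_weierstrassZetaExcept (z := z) fun h ↦ hz h.1)
  rw [L.weierstrassP_eq_add_except]
  convert! h1 using 1
  · ext w
    simp [weierstrassZeta]
  · simp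
    ring

theorem eventually_notMem_lattice {z : ℂ} (hz : z ∉ L.lattice) :
    ∀ᶠ w in 𝓝 z, w ∉ L.lattice :=
  L.isClosed_lattice.isOpen_compl.mem_nhds hz

theorem eventually_punctured_notMem_lattice : ∀ᶠ w in 𝓝[≠] (0 : ℂ), w ∉ L.lattice := by
  have h := L.compl_lattice_sdiff_singleton_mem_nhds 0
  filter_upwards [nhdsWithin_le_nhds h, self_mem_nhdsWithin] with w hw hw0 hmem
  exact hw ⟨hmem, hw0⟩

theorem countable_lattice : (L.lattice : Set ℂ).Countable :=
  Set.countable_coe_iff.mp (L.latticeEquivProd.toEquiv.countable_iff.mpr inferInstance)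

/-- Identity principle on the complement of a countable closed set, starting from a punctured
neighbourhood. -/
theorem eqOn_zero_of_eventually_punctured {K : Set ℂ} (hK : K.Countable) (hKc : IsClosed K)
    {E : ℂ → ℂ} (hE : DifferentiableOn ℂ E Kᶜ) {a : ℂ}
    (h : ∀ᶠ u in 𝓝[≠] a, u ∉ K ∧ E u = 0) {z : ℂ} (hz : z ∉ K) : E z = 0 := by
  obtain ⟨u, hu, hua⟩ :=
    ((eventually_eventually_nhdsWithin.mpr h).and self_mem_nhdsWithin).exists
  rw [isOpen_compl_singleton.nhdsWithin_eq hua] at hu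
  have hconn : IsPreconnected Kᶜ :=
    (hK.isPathConnected_compl_of_one_lt_rank (by simp)).isConnected.isPreconnected
  exact (hE.analyticOnNhd hKc.isOpen_compl).eqOn_zero_of_preconnected_of_eventuallyEq_zero hconn
    hu.self_of_nhds.1 (hu.mono fun _ h ↦ h.2) hz

theorem differentiableAt_derivWeierstrassP {z : ℂ} (hz : z ∉ L.lattice) :
    DifferentiableAt ℂ L.derivWeierstrassP z :=
  (L.analyticOnNhd_derivWeierstrassP z hz).differentiableAt

theorem eventually_punctured_derivWeierstrassP_ne_zero :
    ∀ᶠ u in 𝓝[≠] (0 : ℂ), L.derivWeierstrassP u ≠ 0 := by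
  have hc : ContinuousAt (fun u : ℂ ↦ -2 + u ^ 3 * L.derivWeierstrassPExcept 0 u) 0 := by
    have := (L.analyticAt_derivWeierstrassPExcept 0).continuousAt
    fun_prop
  have hne := hc.eventually_ne (y := 0) (by simp)
  filter_upwards [nhdsWithin_le_nhds hne, self_mem_nhdsWithin] with u hu hu0 h
  have hu0 : u ≠ 0 := hu0
  apply hu
  rw [L.derivWeierstrassP_eq_add_except] at h
  field_simp at h
  linear_combination h

/-- The second order differential equation `℘'' = 6℘² - g₂ / 2`. -/
theorem hasDerivAt_derivWeierstrassP {z : ℂ} (hz : z ∉ L.lattice) :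
    HasDerivAt L.derivWeierstrassP (6 * L.weierstrassP z ^ 2 - L.g₂ / 2) z := by
  have key (w : ℂ) (hw : w ∉ L.lattice) :
      L.derivWeierstrassP w *
        (deriv L.derivWeierstrassP w - (6 * L.weierstrassP w ^ 2 - L.g₂ / 2)) = 0 := by
    have h1 := (L.differentiableAt_derivWeierstrassP hw).hasDerivAt.fun_pow 2
    have hP := L.hasDerivAt_weierstrassP hw
    have h2 := (((hP.fun_pow 3).const_mul 4).fun_sub (hP.const_mul L.g₂)).sub_const L.g₃
    have h3 := h1.unique (h2.congr_of_eventuallyEq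
      ((L.eventually_notMem_lattice hw).mono fun v hv ↦ L.derivWeierstrassP_sq v hv))
    push_cast at h3
    linear_combination h3 / 2
  have h0 : deriv L.derivWeierstrassP z - (6 * L.weierstrassP z ^ 2 - L.g₂ / 2) = 0 := by
    refine eqOn_zero_of_eventually_punctured (K := L.lattice)
      (E := fun w ↦ deriv L.derivWeierstrassP w - (6 * L.weierstrassP w ^ 2 - L.g₂ / 2))
      L.countable_lattice L.isClosed_lattice (fun w hw ↦ ?_) (a := 0) ?_ hz
    · have h1 := (L.analyticOnNhd_derivWeierstrassP w hw).deriv.differentiableAt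
      have h2 := (L.hasDerivAt_weierstrassP hw).differentiableAt
      exact DifferentiableAt.differentiableWithinAt (by fun_prop)
    · filter_upwards [L.eventually_punctured_notMem_lattice,
        L.eventually_punctured_derivWeierstrassP_ne_zero] with w hw hne
      exact ⟨hw, (mul_eq_zero.mp (key w hw)).resolve_left hne⟩
  rw [← sub_eq_zero.mp h0]
  exact (L.differentiableAt_derivWeierstrassP hz).hasDerivAt

theorem hasDerivAt_const_sub_comp {f : ℂ → ℂ} {f' c u : ℂ} (hf : HasDerivAt f f' (c - u)) :
    HasDerivAt (fun v ↦ f (c - v)) (-f') u := by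
  simpa using! hf.comp_const_sub c u

theorem eventually_punctured_weierstrassP_ne {g : ℂ → ℂ} (hg : ContinuousAt g 0) :
    ∀ᶠ u in 𝓝[≠] (0 : ℂ), L.weierstrassP u ≠ g u := by
  have hc : ContinuousAt (fun u : ℂ ↦ 1 + u ^ 2 * (L.weierstrassPExcept 0 u - g u)) 0 := by
    have := (L.analyticAt_weierstrassPExcept 0).continuousAt
    fun_prop
  have hne := hc.eventually_ne (y := 0) (by simp)
  filter_upwards [nhdsWithin_le_nhds hne, self_mem_nhdsWithin] with u hu hu0 h
  have hu0 : u ≠ 0 := hu0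
  apply hu
  rw [L.weierstrassP_eq_add_except] at h
  field_simp at h
  linear_combination h

/-- The difference of the two sides of the addition theorem for `ζ` has vanishing derivative. -/
theorem hasDerivAt_weierstrassZeta_addition_defect {c u : ℂ} (hu : u ∉ L.lattice)
    (hcu : c - u ∉ L.lattice) (hne : L.weierstrassP u ≠ L.weierstrassP (c - u)) :
    HasDerivAt (fun u ↦ L.weierstrassZeta c - L.weierstrassZeta u - L.weierstrassZeta (c - u) -
      (L.derivWeierstrassP u - L.derivWeierstrassP (c - u)) /
        (2 * (L.weierstrassP u - L.weierstrassP (c - u)))) 0 u := by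
  have hd : L.weierstrassP u - L.weierstrassP (c - u) ≠ 0 := sub_ne_zero.mpr hne
  have h1 := ((L.hasDerivAt_weierstrassZeta hu).const_sub (L.weierstrassZeta c)).fun_sub
    (hasDerivAt_const_sub_comp (L.hasDerivAt_weierstrassZeta hcu))
  have h2 := (L.hasDerivAt_derivWeierstrassP hu).fun_sub
    (hasDerivAt_const_sub_comp (L.hasDerivAt_derivWeierstrassP hcu))
  have h3 := ((L.hasDerivAt_weierstrassP hu).fun_sub
    (hasDerivAt_const_sub_comp (L.hasDerivAt_weierstrassP hcu))).const_mul 2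
  refine (h1.fun_sub (h2.fun_div h3 (mul_ne_zero two_ne_zero hd))).congr_deriv ?_
  have r1 := L.derivWeierstrassP_sq u hu
  have r2 := L.derivWeierstrassP_sq _ hcu
  field_simp
  linear_combination 2 * r1 - 2 * r2

theorem weierstrassZeta_addition_eventually {c : ℂ} (hc : c ∉ L.lattice) :
    ∀ᶠ u in 𝓝[≠] (0 : ℂ), 2 * (L.weierstrassZeta c - L.weierstrassZeta u -
        L.weierstrassZeta (c - u)) * (L.weierstrassP u - L.weierstrassP (c - u)) =
      L.derivWeierstrassP u - L.derivWeierstrassP (c - u) := by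
  let V : ℂ → ℂ := fun u ↦ L.weierstrassZeta c - L.weierstrassZetaExcept u -
    L.weierstrassZeta (c - u) -
    (u ^ 2 * (L.derivWeierstrassPExcept 0 u - L.derivWeierstrassP (c - u)) / 2 +
      u * (L.weierstrassPExcept 0 u - L.weierstrassP (c - u))) /
      (1 + u ^ 2 * (L.weierstrassPExcept 0 u - L.weierstrassP (c - u)))
  have hg : ∀ᶠ u in 𝓝 (0 : ℂ), c - u ∉ L.lattice := by
    have : ContinuousAt (fun u : ℂ ↦ c - u) 0 := by fun_prop
    exact this.eventually (L.eventually_notMem_lattice (by simpa using hc))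
  have hΛ : ∀ᶠ u in 𝓝 (0 : ℂ), u ∈ ((L.lattice : Set ℂ) \ {0})ᶜ :=
    L.compl_lattice_sdiff_singleton_mem_nhds 0
  have hcont : ContinuousAt (fun u ↦ L.weierstrassP (c - u)) 0 :=
    (hasDerivAt_const_sub_comp
      (L.hasDerivAt_weierstrassP (by simpa using hc))).continuousAt
  have hden : ∀ᶠ u in 𝓝 (0 : ℂ),
      1 + u ^ 2 * (L.weierstrassPExcept 0 u - L.weierstrassP (c - u)) ≠ 0 := by
    have hc' : ContinuousAt (fun u : ℂ ↦
        1 + u ^ 2 * (L.weierstrassPExcept 0 u - L.weierstrassP (c - u))) 0 := by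
      have := (L.analyticAt_weierstrassPExcept 0).continuousAt
      fun_prop
    exact hc'.eventually_ne (by simp)
  have hVd : ∀ᶠ u in 𝓝 (0 : ℂ), DifferentiableAt ℂ V u := by
    filter_upwards [hg, hΛ, hden] with u h1 h2 h3
    have d1 := (L.hasDerivAt_weierstrassZetaExcept h2).differentiableAt
    have d2 := (hasDerivAt_const_sub_comp (L.hasDerivAt_weierstrassZeta h1)).differentiableAt
    have d3 := (hasDerivAt_const_sub_comp (L.hasDerivAt_weierstrassP h1)).differentiableAt
    have d4 := (hasDerivAt_const_sub_comp (L.hasDerivAt_derivWeierstrassP h1)).differentiableAt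
    have d5 := (L.analyticOnNhd_weierstrassPExcept 0 u h2).differentiableAt
    have d6 := (L.analyticOnNhd_derivWeierstrassPExcept 0 u h2).differentiableAt
    exact DifferentiableAt.fun_sub (by fun_prop)
      (DifferentiableAt.fun_div (by fun_prop) (by fun_prop) h3)
  have hVeq : ∀ᶠ u in 𝓝[≠] (0 : ℂ), V u =
      L.weierstrassZeta c - L.weierstrassZeta u - L.weierstrassZeta (c - u) -
      (L.derivWeierstrassP u - L.derivWeierstrassP (c - u)) /
        (2 * (L.weierstrassP u - L.weierstrassP (c - u))) := by
    filter_upwards [L.eventually_punctured_weierstrassP_ne hcont, self_mem_nhdsWithin,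
      nhdsWithin_le_nhds hden] with u hne hu0 hd
    have hu0 : u ≠ 0 := hu0
    have e : L.weierstrassP u - L.weierstrassP (c - u) =
        (1 + u ^ 2 * (L.weierstrassPExcept 0 u - L.weierstrassP (c - u))) / u ^ 2 := by
      rw [L.weierstrassP_eq_add_except u]
      field_simp
      ring
    rw [e, L.derivWeierstrassP_eq_add_except u]
    simp only [V, weierstrassZeta]
    generalize L.weierstrassPExcept 0 u - L.weierstrassP (c - u) = k at *
    field_simp
    ring
  have hdV : ∀ᶠ u in 𝓝[≠] (0 : ℂ), deriv V u = 0 := by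
    filter_upwards [eventually_eventually_nhdsWithin.mpr hVeq, self_mem_nhdsWithin,
      nhdsWithin_le_nhds hg, L.eventually_punctured_notMem_lattice,
      L.eventually_punctured_weierstrassP_ne hcont] with u he hu0 h1 h2 h3
    rw [isOpen_compl_singleton.nhdsWithin_eq hu0] at he
    exact ((L.hasDerivAt_weierstrassZeta_addition_defect h2 h1 h3).congr_of_eventuallyEq he).deriv
  have hVa : AnalyticAt ℂ V 0 := Complex.analyticAt_iff_eventually_differentiableAt.mpr hVd
  have hdV0 : ∀ᶠ u in 𝓝 (0 : ℂ), deriv V u = 0 :=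
    hVa.deriv.frequently_zero_iff_eventually_zero.mp hdV.frequently
  obtain ⟨ε, hε, hball⟩ := Metric.eventually_nhds_iff_ball.mp (hVd.and hdV0)
  have hV0 : V 0 = 0 := by simp [V]
  have hV : ∀ u ∈ Metric.ball (0 : ℂ) ε, V u = 0 := fun u hu ↦ by
    rw [← hV0]
    exact Metric.isOpen_ball.is_const_of_deriv_eq_zero
      (convex_ball _ _).isPreconnected
      (fun v hv ↦ (hball v hv).1.differentiableWithinAt) (fun v hv ↦ (hball v hv).2) hu
      (Metric.mem_ball_self hε)
  filter_upwards [nhdsWithin_le_nhds (Metric.ball_mem_nhds 0 hε), hVeq,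
    L.eventually_punctured_weierstrassP_ne hcont] with u hu he hne
  have hd : L.weierstrassP u - L.weierstrassP (c - u) ≠ 0 := sub_ne_zero.mpr hne
  rw [hV u hu] at he
  field_simp at he
  linear_combination -he

/-- The addition theorem for the Weierstrass zeta function. -/
theorem weierstrassZeta_add {z w : ℂ} (hz : z ∉ L.lattice) (hw : w ∉ L.lattice)
    (hzw : z + w ∉ L.lattice) :
    2 * (L.weierstrassZeta (z + w) - L.weierstrassZeta z - L.weierstrassZeta w) *
        (L.weierstrassP z - L.weierstrassP w) =
      L.derivWeierstrassP z - L.derivWeierstrassP w := by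
  set c := z + w with hc
  let K : Set ℂ := L.lattice ∪ (c - ·) ⁻¹' L.lattice
  have hK : K.Countable := L.countable_lattice.union
    (L.countable_lattice.preimage sub_right_injective)
  have hKc : IsClosed K := L.isClosed_lattice.union
    (L.isClosed_lattice.preimage (by fun_prop))
  have hzK : z ∉ K := by
    rintro (h | h)
    · exact hz h
    · exact hw (by simpa [hc] using h)
  have hE := eqOn_zero_of_eventually_punctured hK hKc (a := 0) (z := z)
    (E := fun u ↦ 2 * (L.weierstrassZeta c - L.weierstrassZeta u - L.weierstrassZeta (c - u)) *
        (L.weierstrassP u - L.weierstrassP (c - u)) -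
      (L.derivWeierstrassP u - L.derivWeierstrassP (c - u))) (fun u hu ↦ ?_) ?_ hzK
  · rw [show c - z = w by simp [hc]] at hE
    linear_combination hE
  · have h1 : u ∉ L.lattice := fun h ↦ hu (Or.inl h)
    have h2 : c - u ∉ L.lattice := fun h ↦ hu (Or.inr h)
    have d1 := (L.hasDerivAt_weierstrassZeta h1).differentiableAt
    have d2 := (L.hasDerivAt_weierstrassP h1).differentiableAt
    have d3 := L.differentiableAt_derivWeierstrassP h1
    have d4 := (hasDerivAt_const_sub_comp (L.hasDerivAt_weierstrassZeta h2)).differentiableAt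
    have d5 := (hasDerivAt_const_sub_comp (L.hasDerivAt_weierstrassP h2)).differentiableAt
    have d6 := (hasDerivAt_const_sub_comp (L.hasDerivAt_derivWeierstrassP h2)).differentiableAt
    exact DifferentiableAt.differentiableWithinAt (by fun_prop)
  · have hg : ∀ᶠ u in 𝓝 (0 : ℂ), c - u ∉ L.lattice := by
      have : ContinuousAt (fun u : ℂ ↦ c - u) 0 := by fun_prop
      exact this.eventually (L.eventually_notMem_lattice (by simpa using hzw))
    filter_upwards [L.weierstrassZeta_addition_eventually hzw, nhdsWithin_le_nhds hg,
      L.eventually_punctured_notMem_lattice] with u h1 h2 h3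
    exact ⟨fun h ↦ h.elim h3 h2, sub_eq_zero.mpr h1⟩

/-- The value `ζ(z + w) - ζ(z - w) - 2ζ(w)`. -/
theorem weierstrassZeta_add_sub_sub {z w : ℂ} (hz : z ∉ L.lattice) (hw : w ∉ L.lattice)
    (hzw : z + w ∉ L.lattice) (hzw' : z - w ∉ L.lattice) :
    (L.weierstrassZeta (z + w) - L.weierstrassZeta (z - w) - 2 * L.weierstrassZeta w) *
        (L.weierstrassP z - L.weierstrassP w) = -L.derivWeierstrassP w := by
  have h1 := L.weierstrassZeta_add hz hw hzw
  have h2 := L.weierstrassZeta_add hz (w := -w) (by simpa using hw) (by simpa [← sub_eq_add_neg])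
  simp only [← sub_eq_add_neg, weierstrassZeta_neg, weierstrassP_neg,
    derivWeierstrassP_neg] at h2
  linear_combination (h1 - h2) / 2

theorem weierstrassZeta_add_add_sub {z w : ℂ} (hz : z ∉ L.lattice) (hw : w ∉ L.lattice)
    (hzw : z + w ∉ L.lattice) (hzw' : z - w ∉ L.lattice) :
    (L.weierstrassZeta (z + w) + L.weierstrassZeta (z - w) - 2 * L.weierstrassZeta z) *
        (L.weierstrassP z - L.weierstrassP w) = L.derivWeierstrassP z := by
  have h1 := L.weierstrassZeta_add hz hw hzw
  have h2 := L.weierstrassZeta_add hz (w := -w) (by simpa using hw) (by simpa [← sub_eq_add_neg])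
  simp only [← sub_eq_add_neg, weierstrassZeta_neg, weierstrassP_neg,
    derivWeierstrassP_neg] at h2
  linear_combination (h1 + h2) / 2

theorem notMem_lattice_of_two_mul {p : ℂ} (hp : 2 * p ∉ L.lattice) : p ∉ L.lattice :=
  fun h ↦ hp (two_mul p ▸ add_mem h h)

/-- `℘'` does not vanish away from the half-periods. -/
theorem derivWeierstrassP_ne_zero {p : ℂ} (hp : 2 * p ∉ L.lattice) :
    L.derivWeierstrassP p ≠ 0 := by
  intro h0
  have hp' := L.notMem_lattice_of_two_mul hp
  let K : Set ℂ := (· + p) ⁻¹' L.lattice ∪ (· - p) ⁻¹' L.lattice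
  have hK : K.Countable := (L.countable_lattice.preimage (add_left_injective p)).union
    (L.countable_lattice.preimage sub_left_injective)
  have hKc : IsClosed K := (L.isClosed_lattice.preimage (by fun_prop)).union
    (L.isClosed_lattice.preimage (by fun_prop))
  have hzero (z : ℂ) (hz : z ∉ K) :
      L.weierstrassZeta (z + p) - L.weierstrassZeta (z - p) - 2 * L.weierstrassZeta p = 0 := by
    refine eqOn_zero_of_eventually_punctured hK hKc (a := 0) (z := z)
      (E := fun z ↦ L.weierstrassZeta (z + p) - L.weierstrassZeta (z - p) -
        2 * L.weierstrassZeta p) (fun u hu ↦ ?_) ?_ hz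
    · have d1 := ((L.hasDerivAt_weierstrassZeta (z := u + p)
        (fun h ↦ hu (Or.inl h))).comp_add_const u p).differentiableAt
      have d2 := ((L.hasDerivAt_weierstrassZeta (z := u - p)
        (fun h ↦ hu (Or.inr h))).comp_sub_const u p).differentiableAt
      exact DifferentiableAt.differentiableWithinAt (by fun_prop)
    · have h0K : (0 : ℂ) ∉ K := by
        rintro (h | h)
        · exact hp' (by simpa using h)
        · exact hp' (by simpa using h)
      filter_upwards [L.eventually_punctured_notMem_lattice,
        nhdsWithin_le_nhds (hKc.isOpen_compl.mem_nhds h0K),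
        L.eventually_punctured_weierstrassP_ne (g := fun _ ↦ L.weierstrassP p)
          continuousAt_const] with u h1 h2 h3
      refine ⟨h2, ?_⟩
      have h4 := L.weierstrassZeta_add_sub_sub h1 hp' (fun h ↦ h2 (Or.inl h))
        (fun h ↦ h2 (Or.inr h))
      rw [h0, neg_zero] at h4
      exact (mul_eq_zero.mp h4).resolve_right (sub_ne_zero.mpr h3)
  have h2p : (0 : ℂ) - 2 * p ∉ L.lattice := by simpa using hp
  have hcont : ContinuousAt (fun t : ℂ ↦ 1 + t * (L.weierstrassZetaExcept t -
      L.weierstrassZeta (t - 2 * p) - 2 * L.weierstrassZeta p)) 0 := by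
    have c1 := (L.hasDerivAt_weierstrassZetaExcept (z := 0) (by simp)).continuousAt
    have c2 := ((L.hasDerivAt_weierstrassZeta h2p).comp_sub_const 0 (2 * p)).continuousAt
    fun_prop
  have hsub : ∀ᶠ t in 𝓝 (0 : ℂ), t - 2 * p ∉ L.lattice := by
    have : ContinuousAt (fun t : ℂ ↦ t - 2 * p) 0 := by fun_prop
    exact this.eventually (L.eventually_notMem_lattice h2p)
  obtain ⟨t, ht1, ht2, ht3, ht0⟩ :=
    (((hcont.eventually_ne (y := 0) (by simp)).filter_mono nhdsWithin_le_nhds).and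
      ((hsub.filter_mono nhdsWithin_le_nhds).and
        (L.eventually_punctured_notMem_lattice.and self_mem_nhdsWithin))).exists
  have ht0 : t ≠ 0 := ht0
  have e : t - p - p = t - 2 * p := by ring
  have h := hzero (t - p) (by
    rintro (h | h)
    · exact ht3 (by simpa using h)
    · exact ht2 (e ▸ h))
  rw [e, sub_add_cancel, weierstrassZeta] at h
  apply ht1
  field_simp at h
  linear_combination h

/-- The sum `℘(z + w) + ℘(z - w)`, obtained by differentiating the addition theorem for `ζ`. -/
theorem weierstrassP_add_add_sub {z w : ℂ} (hz : z ∉ L.lattice) (hw : w ∉ L.lattice)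
    (hzw : z + w ∉ L.lattice) (hzw' : z - w ∉ L.lattice) :
    (2 * L.weierstrassP z - (L.weierstrassP (z + w) + L.weierstrassP (z - w))) *
        (L.weierstrassP z - L.weierstrassP w) ^ 2 + L.derivWeierstrassP z ^ 2 =
      (6 * L.weierstrassP z ^ 2 - L.g₂ / 2) * (L.weierstrassP z - L.weierstrassP w) := by
  have e1 : ∀ᶠ u in 𝓝 z, u + w ∉ L.lattice :=
    (show ContinuousAt (· + w) z by fun_prop).eventually (L.eventually_notMem_lattice hzw)
  have e2 : ∀ᶠ u in 𝓝 z, u - w ∉ L.lattice :=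
    (show ContinuousAt (· - w) z by fun_prop).eventually (L.eventually_notMem_lattice hzw')
  have h1 := ((((L.hasDerivAt_weierstrassZeta hzw).comp_add_const z w).fun_add
    ((L.hasDerivAt_weierstrassZeta hzw').comp_sub_const z w)).fun_sub
    ((L.hasDerivAt_weierstrassZeta hz).const_mul 2)).fun_mul
    ((L.hasDerivAt_weierstrassP hz).sub_const (L.weierstrassP w))
  have h2 := h1.unique ((L.hasDerivAt_derivWeierstrassP hz).congr_of_eventuallyEq (by
    filter_upwards [L.eventually_notMem_lattice hz, e1, e2] with u a b c
    exact L.weierstrassZeta_add_add_sub a hw b c))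
  linear_combination (L.weierstrassP z - L.weierstrassP w) * h2 -
    L.derivWeierstrassP z * L.weierstrassZeta_add_add_sub hz hw hzw hzw'

/-- The duplication formula for `ζ`. -/
theorem weierstrassZeta_two_mul {p : ℂ} (hp : 2 * p ∉ L.lattice) :
    2 * (L.weierstrassZeta (2 * p) - 2 * L.weierstrassZeta p) * L.derivWeierstrassP p =
      6 * L.weierstrassP p ^ 2 - L.g₂ / 2 := by
  have hp' := L.notMem_lattice_of_two_mul hp
  rw [two_mul p] at hp ⊢
  have e1 : ∀ᶠ u in 𝓝 p, u + p ∉ L.lattice :=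
    (show ContinuousAt (· + p) p by fun_prop).eventually (L.eventually_notMem_lattice hp)
  have h1 := (((((L.hasDerivAt_weierstrassZeta hp).comp_add_const p p).fun_sub
    (L.hasDerivAt_weierstrassZeta hp')).sub_const (L.weierstrassZeta p)).const_mul 2).fun_mul
    ((L.hasDerivAt_weierstrassP hp').sub_const (L.weierstrassP p))
  have h2 := h1.unique (((L.hasDerivAt_derivWeierstrassP hp').sub_const
    (L.derivWeierstrassP p)).congr_of_eventuallyEq (by
    filter_upwards [L.eventually_notMem_lattice hp', e1] with u a b
    exact L.weierstrassZeta_add a hp' b))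
  linear_combination h2

/-- The duplication formula for `℘`. -/
theorem weierstrassP_two_mul {p : ℂ} (hp : 2 * p ∉ L.lattice) :
    4 * (L.weierstrassP (2 * p) + 2 * L.weierstrassP p) * L.derivWeierstrassP p ^ 2 =
      (6 * L.weierstrassP p ^ 2 - L.g₂ / 2) ^ 2 := by
  have hp' := L.notMem_lattice_of_two_mul hp
  have e1 : ∀ᶠ u in 𝓝 p, 2 * u ∉ L.lattice :=
    (show ContinuousAt (2 * ·) p by fun_prop).eventually (L.eventually_notMem_lattice hp)
  have h1 := (((((L.hasDerivAt_weierstrassZeta hp).comp p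
    ((hasDerivAt_id p).const_mul (2 : ℂ))).fun_sub
    ((L.hasDerivAt_weierstrassZeta hp').const_mul 2)).const_mul 2).fun_mul
    (L.hasDerivAt_derivWeierstrassP hp'))
  have h2 := h1.unique (((((L.hasDerivAt_weierstrassP hp').fun_pow 2).const_mul 6).sub_const
    (L.g₂ / 2)).congr_of_eventuallyEq (by
    filter_upwards [e1] with u a
    exact L.weierstrassZeta_two_mul a))
  have h3 := L.weierstrassZeta_two_mul hp
  simp only [Function.comp_apply] at h2
  push_cast at h2
  linear_combination (6 * L.weierstrassP p ^ 2 - L.g₂ / 2) * h3 - L.derivWeierstrassP p * h2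

end PeriodPair

/-- The period pair `(1, τ)` of a point of the upper half-plane. -/
def tauPeriodPair (τ : ℂ) (hτ : 0 < τ.im) : PeriodPair where
  ω₁ := 1
  ω₂ := τ
  indep := by
    rw [LinearIndependent.pair_iff]
    intro s t h
    have him := congrArg Complex.im h
    have ht : t = 0 := by simpa [hτ.ne'] using him
    subst ht
    exact ⟨by simpa using congrArg Complex.re h, rfl⟩

section

variable (τ : ℂ) (hτ : 0 < τ.im)

theorem mem_tauPeriodPair_lattice {z : ℂ} : z ∈ (tauPeriodPair τ hτ).lattice ↔ z ∈ Lam τ := by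
  rw [PeriodPair.mem_lattice]
  simp [tauPeriodPair, Lam, eq_comm]

/-- The nonzero lattice points as a subtype of the lattice. -/
def lamEquiv : Lam' τ ≃ {l : (tauPeriodPair τ hτ).lattice // (l : ℂ) ≠ 0} where
  toFun ω := ⟨⟨ω, (mem_tauPeriodPair_lattice τ hτ).mpr ω.2.1⟩, ω.2.2⟩
  invFun l := ⟨l.1, (mem_tauPeriodPair_lattice τ hτ).mp l.1.2, l.2⟩

theorem tsum_Lam' (f : ℂ → ℂ) :
    ∑' ω : Lam' τ, f ω = ∑' l : (tauPeriodPair τ hτ).lattice, if (l : ℂ) = 0 then 0 else f l := by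
  rw [← (lamEquiv τ hτ).symm.tsum_eq]
  have h := tsum_subtype {l : (tauPeriodPair τ hτ).lattice | (l : ℂ) ≠ 0} (fun l ↦ f l)
  refine Eq.trans h (tsum_congr fun l ↦ ?_)
  by_cases hl : (l : ℂ) = 0 <;>
    simp only [Set.indicator_apply, Set.mem_ofPred_eq, ne_eq, hl] <;> simp

theorem wp_eq : wp τ = (tauPeriodPair τ hτ).weierstrassP := by
  ext z
  rw [PeriodPair.weierstrassP_eq_add_except, wp,
    tsum_Lam' τ hτ (fun ω ↦ 1 / (z - ω) ^ 2 - 1 / ω ^ 2)]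
  rfl

theorem wzeta_eq : wzeta τ = (tauPeriodPair τ hτ).weierstrassZeta := by
  ext z
  rw [PeriodPair.weierstrassZeta, wzeta,
    tsum_Lam' τ hτ (fun ω ↦ 1 / (z - ω) + 1 / ω + z / ω ^ 2)]
  rfl

end

/-- The derivative of `(iC + Φ' / 2) / Φ` in terms of the derivatives of `Φ`. -/
theorem hasDerivAt_riccati_quotient {Φ : ℂ → ℂ} {z Φ₂ C : ℂ}
    (h1 : HasDerivAt Φ (deriv Φ z) z) (h2 : HasDerivAt (deriv Φ) Φ₂ z) (h0 : Φ z ≠ 0) :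
    HasDerivAt (fun w ↦ (Complex.I * C + 1 / 2 * deriv Φ w) / Φ w)
      ((Φ z * Φ₂ / 2 - deriv Φ z ^ 2 / 4 - C ^ 2) / Φ z ^ 2 -
        ((Complex.I * C + 1 / 2 * deriv Φ z) / Φ z) ^ 2) z := by
  refine (((h2.const_mul (1 / 2)).const_add (Complex.I * C)).fun_div h1 h0).congr_deriv ?_
  field_simp
  linear_combination (16 * C ^ 2) * Complex.I_sq

/-- The polynomial identity behind the spectral curve, in terms of `m = ℘''(p) / ℘'(p)`,
`b = ℘'(p)`, `d = ℘(z) - ℘(p)`. -/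
theorem spectral_identity {A a b m d K P y₂ x₂ s q : ℂ} (hd : d ≠ 0)
    (hK : K = (A / 2 - 3 * m / 8) * b)
    (hP : P = d - K / d - A ^ 2 + m / 2 * A + 3 / 16 * m ^ 2)
    (hy : y₂ = b ^ 2 + 2 * (m * b) * d + 12 * a * d ^ 2 + 4 * d ^ 3)
    (hx : x₂ = m * b + 12 * a * d + 6 * d ^ 2)
    (hs : s = 2 * (a + d) - (x₂ / d - y₂ / d ^ 2))
    (hq : q = 2 * (a + d) + 3 / 4 * s - A * b / d + A ^ 2 - m / 2 * A
      - 3 / 4 * (-2 * a + m ^ 2 / 4) - 2 * a) :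
    P * ((1 + K / d ^ 2) * x₂ - 2 * K / d ^ 3 * y₂) / 2 - (1 + K / d ^ 2) ^ 2 * y₂ / 4 - q * P ^ 2 =
      -((A ^ 3 - 5 / 4 * m * A ^ 2 + 3 * (a + m ^ 2 / 16) * A + b / 2 - 9 / 4 * m * a
          + 9 / 64 * m ^ 3) *
        (A ^ 3 - m / 4 * A ^ 2 - 5 / 16 * m ^ 2 * A + 2 * b - 3 / 64 * m ^ 3)) := by
  subst hq hs hP hK hy hx
  field_simp
  ring

/-- `Φ_e` as a rational function of `℘(z) - ℘(p)`. -/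
theorem Phie_eq {τ p : ℂ} (hτ : 0 < τ.im) (hp : 2 * p ∉ Lam τ) (A : ℂ) {z : ℂ}
    (hz : z ∉ Sset τ p) :
    wp τ z - wp τ p ≠ 0 ∧
    Phie τ p A z = wp τ z - wp τ p -
      (A / 2 - 3 * (wpdd τ p / wpd τ p) / 8) * wpd τ p / (wp τ z - wp τ p) - A ^ 2 +
      (wpdd τ p / wpd τ p) / 2 * A + 3 / 16 * (wpdd τ p / wpd τ p) ^ 2 := by
  let L := tauPeriodPair τ hτ
  have hmem (x : ℂ) : x ∈ L.lattice ↔ x ∈ Lam τ := mem_tauPeriodPair_lattice τ hτ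
  have hp2 : 2 * p ∉ L.lattice := by rwa [hmem]
  have hz1 : z ∉ L.lattice := fun h ↦ hz (Or.inl (Or.inl ((hmem _).mp h)))
  have hz2 : z - p ∉ L.lattice := fun h ↦ hz (Or.inl (Or.inr ((hmem _).mp h)))
  have hz3 : z + p ∉ L.lattice := fun h ↦ hz (Or.inr ((hmem _).mp h))
  have hb : L.derivWeierstrassP p ≠ 0 := L.derivWeierstrassP_ne_zero hp2
  have hadd := L.weierstrassZeta_add_sub_sub hz1 (L.notMem_lattice_of_two_mul hp2) hz3 hz2
  have hd : L.weierstrassP z - L.weierstrassP p ≠ 0 := by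
    intro h
    rw [h, mul_zero] at hadd
    exact hb (neg_eq_zero.mp hadd.symm)
  have hwpd : wpd τ p = L.derivWeierstrassP p := by
    rw [wpd, wp_eq τ hτ, PeriodPair.deriv_weierstrassP]
  have hwp : wp τ = L.weierstrassP := wp_eq τ hτ
  have hwz : wzeta τ = L.weierstrassZeta := wzeta_eq τ hτ
  rw [Phie, hwp, hwz, hwpd]
  refine ⟨hd, ?_⟩
  have h : L.weierstrassZeta (z + p) - L.weierstrassZeta (z - p) =
      2 * L.weierstrassZeta p - L.derivWeierstrassP p / (L.weierstrassP z - L.weierstrassP p) := by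
    field_simp
    linear_combination hadd
  rw [h]
  field_simp
  ring

/-- `φ` satisfies the Riccati equation `φ' = q − φ²` wherever defined. -/
theorem stmt_4 (τ p : ℂ) (hτ : 0 < τ.im) (hp : 2 * p ∉ Lam τ) (A C : ℂ)
    (hC : C ^ 2 = -(Y1 τ p A * Y2 τ p A)) :
    ∀ z ∉ Sset τ p, Phie τ p A z ≠ 0 →
      deriv (phiBA τ p A C) z = qpot τ p A z - (phiBA τ p A C z) ^ 2 := by
  intro z hz hΦ
  let L := tauPeriodPair τ hτ
  have hmem (x : ℂ) : x ∈ L.lattice ↔ x ∈ Lam τ := mem_tauPeriodPair_lattice τ hτ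
  have hp2 : 2 * p ∉ L.lattice := by rwa [hmem]
  have hp1 := L.notMem_lattice_of_two_mul hp2
  have hz1 : z ∉ L.lattice := fun h ↦ hz (Or.inl (Or.inl ((hmem _).mp h)))
  have hz2 : z - p ∉ L.lattice := fun h ↦ hz (Or.inl (Or.inr ((hmem _).mp h)))
  have hz3 : z + p ∉ L.lattice := fun h ↦ hz (Or.inr ((hmem _).mp h))
  have hS : ∀ᶠ w in 𝓝 z, w ∉ Sset τ p ∧ w ∉ L.lattice := by
    filter_upwards [L.eventually_notMem_lattice hz1,
      (show ContinuousAt (· - p) z by fun_prop).eventually (L.eventually_notMem_lattice hz2),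
      (show ContinuousAt (· + p) z by fun_prop).eventually (L.eventually_notMem_lattice hz3)]
      with w h1 h2 h3
    refine ⟨?_, h1⟩
    rintro ((h | h) | h)
    · exact h1 ((hmem _).mpr h)
    · exact h2 ((hmem _).mpr h)
    · exact h3 ((hmem _).mpr h)
  have hwp : wp τ = L.weierstrassP := wp_eq τ hτ
  have hwz : wzeta τ = L.weierstrassZeta := wzeta_eq τ hτ
  have hwpd : wpd τ p = L.derivWeierstrassP p := by
    rw [wpd, hwp, PeriodPair.deriv_weierstrassP]
  have hwpdd : wpdd τ p = 6 * L.weierstrassP p ^ 2 - L.g₂ / 2 := by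
    rw [wpdd, hwp, PeriodPair.deriv_weierstrassP]
    exact (L.hasDerivAt_derivWeierstrassP hp1).deriv
  have hb : L.derivWeierstrassP p ≠ 0 := L.derivWeierstrassP_ne_zero hp2
  obtain ⟨m, hm⟩ : ∃ m, m = wpdd τ p / wpd τ p := ⟨_, rfl⟩
  have hmb : 6 * L.weierstrassP p ^ 2 - L.g₂ / 2 = m * L.derivWeierstrassP p := by
    rw [hm, hwpdd, hwpd]
    field_simp
  obtain ⟨K, hK⟩ : ∃ K, K = (A / 2 - 3 * m / 8) * L.derivWeierstrassP p := ⟨_, rfl⟩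
  have hrat (w : ℂ) (hw : w ∉ Sset τ p) : L.weierstrassP w - L.weierstrassP p ≠ 0 ∧
      Phie τ p A w = L.weierstrassP w - L.weierstrassP p -
        K / (L.weierstrassP w - L.weierstrassP p) - A ^ 2 + m / 2 * A + 3 / 16 * m ^ 2 := by
    have := Phie_eq hτ hp A hw
    rwa [← hm, hwp, hwpd, ← hK] at this
  have hderiv (w : ℂ) (hw : ∀ᶠ v in 𝓝 w, v ∉ Sset τ p ∧ v ∉ L.lattice) :
      HasDerivAt (Phie τ p A)
        (L.derivWeierstrassP w * (1 + K / (L.weierstrassP w - L.weierstrassP p) ^ 2)) w := by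
    have hd := (hrat w hw.self_of_nhds.1).1
    have h1 := (L.hasDerivAt_weierstrassP hw.self_of_nhds.2).sub_const (L.weierstrassP p)
    have h2 := (((h1.fun_sub ((hasDerivAt_const w K).fun_div h1 hd)).sub_const
      (A ^ 2)).add_const (m / 2 * A)).add_const (3 / 16 * m ^ 2)
    refine (h2.congr_of_eventuallyEq (hw.mono fun v hv ↦ (hrat v hv.1).2)).congr_deriv ?_
    field_simp
    ring
  obtain ⟨hd, hPz⟩ := hrat z hz
  have hsq := L.derivWeierstrassP_sq z hz1
  have hsqp := L.derivWeierstrassP_sq p hp1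
  have hdz : deriv (Phie τ p A) z = _ := (hderiv z hS).deriv
  have hderiv₂ : HasDerivAt (deriv (Phie τ p A))
      ((1 + K / (L.weierstrassP z - L.weierstrassP p) ^ 2) *
        (6 * L.weierstrassP z ^ 2 - L.g₂ / 2) -
        2 * K / (L.weierstrassP z - L.weierstrassP p) ^ 3 * L.derivWeierstrassP z ^ 2) z := by
    have h1 := (L.hasDerivAt_weierstrassP hz1).sub_const (L.weierstrassP p)
    have h2 := (L.hasDerivAt_derivWeierstrassP hz1).fun_mul
      (((hasDerivAt_const z K).fun_div (h1.fun_pow 2) (pow_ne_zero 2 hd)).const_add 1)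
    refine (h2.congr_of_eventuallyEq ((eventually_eventually_nhds.mpr hS).mono
      fun w hw ↦ (hderiv w hw).deriv)).congr_deriv ?_
    field_simp
    ring
  have hsum := L.weierstrassP_add_add_sub hz1 hp1 hz3 hz2
  have hzeta := L.weierstrassZeta_add_sub_sub hz1 hp1 hz3 hz2
  have hzeta2 := L.weierstrassZeta_two_mul hp2
  have hP2 := L.weierstrassP_two_mul hp2
  rw [hmb] at hzeta2 hP2
  have hzeta2' : L.weierstrassZeta (2 * p) = 2 * L.weierstrassZeta p + m / 2 :=
    mul_right_cancel₀ hb (by linear_combination hzeta2 / 2)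
  have hP2' : L.weierstrassP (2 * p) = -2 * L.weierstrassP p + m ^ 2 / 4 :=
    mul_right_cancel₀ (pow_ne_zero 2 hb) (by linear_combination hP2 / 4)
  have hdiff : L.weierstrassZeta (z + p) - L.weierstrassZeta (z - p) =
      2 * L.weierstrassZeta p -
        L.derivWeierstrassP p / (L.weierstrassP z - L.weierstrassP p) := by
    field_simp
    linear_combination hzeta
  have hY : Y1 τ p A * Y2 τ p A =
      (A ^ 3 - 5 / 4 * m * A ^ 2 + 3 * (L.weierstrassP p + m ^ 2 / 16) * A +
          L.derivWeierstrassP p / 2 - 9 / 4 * m * L.weierstrassP p + 9 / 64 * m ^ 3) *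
        (A ^ 3 - m / 4 * A ^ 2 - 5 / 16 * m ^ 2 * A + 2 * L.derivWeierstrassP p -
          3 / 64 * m ^ 3) := by
    rw [Y1, Y2, hwpdd, hwpd, hwp, hmb]
    field_simp
  have key := spectral_identity (A := A) (a := L.weierstrassP p) (b := L.derivWeierstrassP p)
    (m := m) (y₂ := L.derivWeierstrassP z ^ 2) (x₂ := 6 * L.weierstrassP z ^ 2 - L.g₂ / 2)
    (s := L.weierstrassP (z + p) + L.weierstrassP (z - p)) (q := qpot τ p A z) hd hK hPz
    (by linear_combination hsq - hsqp + 2 * (L.weierstrassP z - L.weierstrassP p) * hmb)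
    (by linear_combination hmb)
    (by
      field_simp
      linear_combination (-2) * hsum)
    (by
      rw [qpot, Bc, hwp, hwz, hzeta2', hP2', hdiff]
      ring)
  rw [← hY, ← hC] at key
  have hφ := (hasDerivAt_riccati_quotient (C := C) (hderiv z hS).differentiableAt.hasDerivAt
    hderiv₂ hΦ).deriv
  refine hφ.trans ?_
  rw [phiBA]
  congr 1
  rw [div_eq_iff (pow_ne_zero 2 hΦ), hdz]
  linear_combination key
end
end

section
/- Let r, s ∈ ℂ and set a = r + sτ; assume 2a ∉ Λ_τ and suppose ζ(a) = r η₁ + s η₂ (i.e. Hecke's function Z(r,s,τ) := ζ(r+sτ) − rη₁ − sη₂ vanishes, equivalently a is a critical point of the Green function). Define f(z) = e^{4ζ(a)z} σ(z−a)² / σ(z+a)². Then, as meromorphic functions, f(z+1) = e^{−4πi(2s)} f(z) and f(z+τ) = e^{4πi(2r)} f(z); that is, f is a type II developing map with monodromy data (2r, 2s). -/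
open Complex Filter Topology

noncomputable section

/-- The quasi-period `η₁ = 2ζ(1/2)`. -/
def eta1 (τ : ℂ) : ℂ := 2 * wzeta τ (1 / 2)

/-- The quasi-period `η₂ = 2ζ(τ/2)`. -/
def eta2 (τ : ℂ) : ℂ := 2 * wzeta τ (τ / 2)

/-- The type II developing map `f(z) = e^{4ζ(a)z} σ(z−a)²/σ(z+a)²`. -/
def fdev (τ a z : ℂ) : ℂ :=
  Complex.exp (4 * wzeta τ a * z) * wsigma τ (z - a) ^ 2 / wsigma τ (z + a) ^ 2

open Finset in
/-- The symmetric partial sums of `∑ 1 / (x - m)` converge to `π cot (π x)`. -/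
lemma tendsto_sum_Icc_inv_sub_int {x : ℂ} (hx : x ∈ Complex.integerComplement) :
    Tendsto (fun N : ℕ ↦ ∑ m ∈ Icc (-N : ℤ) N, 1 / (x - m)) atTop
      (𝓝 (Real.pi * Complex.cot (Real.pi * x))) := by
  have h := (tendsto_logDeriv_euler_cot_sub hx).add_const (1 / x)
  rw [sub_add_cancel] at h
  refine h.congr fun N ↦ ?_
  induction N with
  | zero => simp
  | succ N ih =>
    rw [sum_range_succ, Nat.cast_succ, sum_Icc_succ_eq_add_endpoints, ← ih]
    push_cast [cotTerm]
    rw [show x - -((N : ℂ) + 1) = x + (N + 1) by ring]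
    ring

lemma hasSum_inv_sub_int_sub_inv_sub_int {x y : ℂ} (hx : x ∈ Complex.integerComplement)
    (hy : y ∈ Complex.integerComplement)
    (h : Summable fun m : ℤ ↦ 1 / (x - m) - 1 / (y - m)) :
    HasSum (fun m : ℤ ↦ 1 / (x - m) - 1 / (y - m))
      (Real.pi * Complex.cot (Real.pi * x) - Real.pi * Complex.cot (Real.pi * y)) := by
  have h1 := h.hasSum.comp (Finset.tendsto_Icc_neg (R := ℤ))
  have h2 := (tendsto_sum_Icc_inv_sub_int hx).sub (tendsto_sum_Icc_inv_sub_int hy)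
  have h3 := tendsto_nhds_unique h1 (h2.congr fun N ↦ by
    simp [Finset.sum_sub_distrib])
  exact h3 ▸ h.hasSum

lemma Complex.tendsto_cot_of_tendsto_im_atTop {ι : Type*} {l : Filter ι} {f : ι → ℂ}
    (hf : Tendsto (fun i ↦ (f i).im) l atTop) :
    Tendsto (fun i ↦ Complex.cot (f i)) l (𝓝 (-I)) := by
  have h1 : Tendsto (fun i ↦ Complex.exp (2 * I * f i)) l (𝓝 0) := by
    rw [tendsto_zero_iff_norm_tendsto_zero]
    simp only [Complex.norm_exp]
    refine Real.tendsto_exp_atBot.comp ?_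
    have : Tendsto (fun i ↦ -(2 * (f i).im)) l atBot :=
      tendsto_neg_atTop_atBot.comp (hf.const_mul_atTop two_pos)
    exact this.congr fun i ↦ by simp
  have h2 := (h1.add_const 1).div ((h1.const_sub 1).const_mul I) (by simp)
  simp only [Complex.cot_eq_exp_ratio]
  rwa [show (0 + 1) / (I * (1 - 0)) = -I by simp] at h2

lemma Complex.tendsto_cot_of_tendsto_im_atBot {ι : Type*} {l : Filter ι} {f : ι → ℂ}
    (hf : Tendsto (fun i ↦ (f i).im) l atBot) :
    Tendsto (fun i ↦ Complex.cot (f i)) l (𝓝 I) := by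
  have h0 : Tendsto (fun i ↦ (-f i).im) l atTop := tendsto_neg_atBot_atTop.comp hf
  have h := (Complex.tendsto_cot_of_tendsto_im_atTop h0).neg
  rw [neg_neg] at h
  refine h.congr fun i ↦ ?_
  simp [Complex.cot, Complex.sin_neg, div_neg]

/-- The parametrisation `(n, m) ↦ nτ + m` of the lattice `Λ_τ`. -/
def latticePoint (τ : ℂ) (p : ℤ × ℤ) : ℂ := p.1 * τ + p.2

lemma range_latticePoint (τ : ℂ) : Set.range (latticePoint τ) = Lam τ := by
  ext x
  simp only [Set.mem_range, Prod.exists, latticePoint, Lam, Set.mem_ofPred_eq]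
  exact ⟨fun ⟨n, m, h⟩ ↦ ⟨m, n, by rw [← h]; ring⟩, fun ⟨m, n, h⟩ ↦ ⟨n, m, by rw [h]; ring⟩⟩

lemma latticePoint_mem (τ : ℂ) (p : ℤ × ℤ) : latticePoint τ p ∈ Lam τ :=
  range_latticePoint τ ▸ Set.mem_range_self p

/-- The period pair `(τ, 1)`. -/
def periodPair {τ : ℂ} (hτ : 0 < τ.im) : PeriodPair where
  ω₁ := τ
  ω₂ := 1
  indep := by
    rw [LinearIndependent.pair_iff]
    intro s t h
    have h1 := congrArg Complex.im h
    have h2 := congrArg Complex.re h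
    simp at h1 h2
    have : s = 0 := h1.resolve_right hτ.ne'
    exact ⟨this, by simpa [this] using h2⟩

lemma coe_lattice_periodPair {τ : ℂ} (hτ : 0 < τ.im) :
    ((periodPair hτ).lattice : Set ℂ) = Lam τ := by
  ext x
  rw [SetLike.mem_coe, PeriodPair.mem_lattice, ← range_latticePoint]
  simp [periodPair, latticePoint]

lemma isOpen_compl_Lam {τ : ℂ} (hτ : 0 < τ.im) : IsOpen (Lam τ)ᶜ := by
  rw [← coe_lattice_periodPair hτ]
  exact (periodPair hτ).isClosed_lattice.isOpen_compl

lemma isPreconnected_compl_Lam (τ : ℂ) : IsPreconnected (Lam τ)ᶜ :=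
  (Set.Countable.isConnected_compl_of_one_lt_rank (by simp)
    (range_latticePoint τ ▸ Set.countable_range _)).isPreconnected

lemma latticePoint_injective {τ : ℂ} (hτ : 0 < τ.im) : Function.Injective (latticePoint τ) := by
  intro p q h
  have h1 := congrArg Complex.im h
  have h2 := congrArg Complex.re h
  simp [latticePoint, hτ.ne'] at h1 h2
  simp [h1] at h2
  exact Prod.ext h1 h2

lemma summable_norm_latticePoint_inv {τ : ℂ} (hτ : 0 < τ.im) :
    Summable fun p ↦ ‖(latticePoint τ p)⁻¹‖ ^ 3 := by
  have h := ZLattice.summable_norm_pow_inv (periodPair hτ).lattice 3 (by simp)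
  refine ((periodPair hτ).latticeEquivProd.symm.toEquiv.summable_iff.mpr h).congr fun p ↦ ?_
  have := (periodPair hτ).latticeEquiv_symm_apply p
  simp only [Function.comp_apply, norm_inv]
  congr 2
  rw [← Submodule.norm_coe]
  exact congrArg norm (this.trans (by simp [periodPair, latticePoint]))

lemma eventually_cofinite_le_norm_latticePoint {τ : ℂ} (hτ : 0 < τ.im) (R : ℝ) :
    ∀ᶠ p in cofinite, R ≤ ‖latticePoint τ p‖ := by
  have hR : 0 < max R 1 := by positivity
  filter_upwards [(summable_norm_latticePoint_inv hτ).tendsto_cofinite_zero.eventually_lt_const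
    (pow_pos (inv_pos.mpr hR) 3), (latticePoint_injective hτ).tendsto_cofinite.eventually
      (eventually_cofinite_ne 0)] with p hp hp0
  have := lt_of_pow_lt_pow_left₀ 3 (by positivity) hp
  rw [norm_inv, inv_lt_inv₀ (by simpa using hp0) hR] at this
  exact (le_max_left _ _).trans this.le

lemma summable_zeta_term {τ : ℂ} (hτ : 0 < τ.im) (z : ℂ) :
    Summable fun p ↦ 1 / (z - latticePoint τ p) + 1 / latticePoint τ p
      + z / latticePoint τ p ^ 2 := by
  refine .of_norm_bounded_eventually
    ((summable_norm_latticePoint_inv hτ).mul_left (2 * ‖z‖ ^ 2)) ?_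
  filter_upwards [eventually_cofinite_le_norm_latticePoint hτ (2 * ‖z‖ + 1)] with p hp
  set w := latticePoint τ p
  have hw : 0 < ‖w‖ := by linarith [norm_nonneg z]
  have hzw : ‖w‖ / 2 ≤ ‖z - w‖ := by
    have := norm_sub_norm_le w z
    rw [norm_sub_rev] at this
    linarith
  have hw0 : w ≠ 0 := norm_pos_iff.mp hw
  have hzw0 : z - w ≠ 0 := norm_pos_iff.mp (by linarith)
  have : 1 / (z - w) + 1 / w + z / w ^ 2 = z ^ 2 * w⁻¹ ^ 2 * (z - w)⁻¹ := by
    field_simp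
    ring
  rw [this, norm_mul, norm_mul, norm_pow, norm_pow]
  have h2 : ‖(z - w)⁻¹‖ ≤ 2 * ‖w⁻¹‖ := by
    rw [norm_inv, norm_inv, inv_le_comm₀ (by linarith) (by positivity)]
    rw [mul_inv, inv_inv]
    linarith
  calc _ ≤ ‖z‖ ^ 2 * ‖w⁻¹‖ ^ 2 * (2 * ‖w⁻¹‖) := by gcongr
    _ = _ := by ring

/-- The nonzero lattice points are parametrised by the nonzero pairs of integers. -/
def latticePointEquiv {τ : ℂ} (hτ : 0 < τ.im) : {p : ℤ × ℤ // p ∉ ({0} : Finset (ℤ × ℤ))} ≃ Lam' τ :=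
  Equiv.ofBijective (fun p ↦ ⟨latticePoint τ p, latticePoint_mem τ p, fun h ↦ p.2 <| by
      simpa using latticePoint_injective hτ (h.trans (by simp [latticePoint] : 0 = latticePoint τ 0))⟩) <| by
    constructor
    · intro p q h
      exact Subtype.ext (latticePoint_injective hτ (congrArg Subtype.val h))
    · rintro ⟨x, hx, hx0⟩
      obtain ⟨p, rfl⟩ := range_latticePoint τ ▸ hx
      refine ⟨⟨p, ?_⟩, rfl⟩
      rintro hp
      apply hx0
      simp [Finset.mem_singleton.mp hp, latticePoint]

lemma latticePointEquiv_apply {τ : ℂ} (hτ : 0 < τ.im) (p) :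
    (latticePointEquiv hτ p : ℂ) = latticePoint τ p := rfl

lemma hasSum_wzeta {τ : ℂ} (hτ : 0 < τ.im) (z : ℂ) :
    HasSum (fun p ↦ 1 / (z - latticePoint τ p) + 1 / latticePoint τ p
      + z / latticePoint τ p ^ 2) (wzeta τ z) := by
  have h := summable_zeta_term hτ z
  convert h.hasSum using 1
  rw [← h.sum_add_tsum_subtype_compl {0}, wzeta, ← (latticePointEquiv hτ).tsum_eq]
  simp [latticePointEquiv_apply, latticePoint]

lemma wzeta_neg (τ z : ℂ) : wzeta τ (-z) = -wzeta τ z := by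
  let e : Lam' τ ≃ Lam' τ := (Equiv.neg ℂ).subtypeEquiv fun x ↦ by
    simp only [Lam', Set.mem_ofPred_eq, Equiv.neg_apply, ne_eq, neg_eq_zero]
    refine and_congr_left fun _ ↦ ⟨fun ⟨m, n, h⟩ ↦ ⟨-m, -n, ?_⟩, fun ⟨m, n, h⟩ ↦ ⟨-m, -n, ?_⟩⟩
    · rw [h]; push_cast; ring
    · rw [← neg_neg x, h]; push_cast; ring
  rw [wzeta, wzeta, ← e.tsum_eq, neg_add, ← tsum_neg]
  congr 1
  · rw [one_div, one_div, inv_neg]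
  · refine tsum_congr fun ω ↦ ?_
    change 1 / (-z - -(ω : ℂ)) + 1 / (-(ω : ℂ)) + -z / (-(ω : ℂ)) ^ 2 = _
    rw [show -z - -(ω : ℂ) = -(z - ω) by ring]
    simp only [div_neg, neg_sq, neg_div]
    ring

lemma add_mem_Lam_iff {τ z w : ℂ} (hw : w ∈ Lam τ) : z + w ∈ Lam τ ↔ z ∈ Lam τ := by
  obtain ⟨a, b, rfl⟩ := hw
  refine ⟨fun ⟨m, n, h⟩ ↦ ⟨m - a, n - b, ?_⟩, fun ⟨m, n, h⟩ ↦ ⟨m + a, n + b, ?_⟩⟩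
  · rw [eq_sub_of_add_eq h]; push_cast; ring
  · rw [h]; push_cast; ring

lemma one_mem_Lam (τ : ℂ) : 1 ∈ Lam τ := ⟨1, 0, by simp⟩

lemma self_mem_Lam (τ : ℂ) : τ ∈ Lam τ := ⟨0, 1, by simp⟩

lemma half_notMem_Lam {τ : ℂ} (hτ : 0 < τ.im) : (1 / 2 : ℂ) ∉ Lam τ := by
  rw [← coe_lattice_periodPair hτ]
  exact (periodPair hτ).ω₂_div_two_notMem_lattice

lemma self_div_two_notMem_Lam {τ : ℂ} (hτ : 0 < τ.im) : τ / 2 ∉ Lam τ := by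
  rw [← coe_lattice_periodPair hτ]
  exact (periodPair hτ).ω₁_div_two_notMem_lattice

lemma sub_int_mul_mem_integerComplement {τ z : ℂ} (hz : z ∉ Lam τ) (n : ℤ) :
    z - n * τ ∈ Complex.integerComplement := by
  rintro ⟨m, h⟩
  exact hz ⟨m, n, by rw [h]; ring⟩

/-- For a lattice vector `w`, the increment `ζ(z + w) - ζ(z)`, summed row by row. -/
lemma hasSum_wzeta_add_sub_wzeta {τ : ℂ} (hτ : 0 < τ.im) {z w : ℂ} (hz : z ∉ Lam τ)
    (hw : w ∈ Lam τ) :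
    HasSum (fun n : ℤ ↦ Real.pi * Complex.cot (Real.pi * (z + w - n * τ))
        - Real.pi * Complex.cot (Real.pi * (z - n * τ))
        + w * ∑' m : ℤ, 1 / (n * τ + m) ^ 2)
      (wzeta τ (z + w) - wzeta τ z) := by
  have h := (hasSum_wzeta hτ (z + w)).sub (hasSum_wzeta hτ z)
  refine h.prod_fiberwise fun n ↦ ?_
  have hS : Summable fun m : ℤ ↦ 1 / ((n : ℂ) * τ + m) ^ 2 :=
    (EisensteinSeries.linear_right_summable τ n (k := 2) le_rfl).congr fun m ↦ by
      rw [one_div]; norm_cast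
  have hrow := h.summable.prod_factor n
  have hd : Summable fun m : ℤ ↦ 1 / (z + w - n * τ - m) - 1 / (z - n * τ - m) := by
    refine (hrow.sub (hS.mul_left w)).congr fun m ↦ ?_
    simp only [latticePoint, sub_sub]
    ring
  have hd' := hasSum_inv_sub_int_sub_inv_sub_int
    (sub_int_mul_mem_integerComplement ((add_mem_Lam_iff hw).not.mpr hz) n)
    (sub_int_mul_mem_integerComplement hz n) hd
  refine (hd'.add (hS.hasSum.mul_left w)).congr_fun ?_
  intro m
  simp only [latticePoint, sub_sub]
  ring

lemma hasSum_wzeta_add_one_sub_wzeta {τ : ℂ} (hτ : 0 < τ.im) {z : ℂ} (hz : z ∉ Lam τ) :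
    HasSum (fun n : ℤ ↦ ∑' m : ℤ, 1 / ((n : ℂ) * τ + m) ^ 2) (wzeta τ (z + 1) - wzeta τ z) := by
  refine (hasSum_wzeta_add_sub_wzeta hτ hz (one_mem_Lam τ)).congr_fun fun n ↦ ?_
  have : Complex.cot (Real.pi * (z + 1 - n * τ)) = Complex.cot (Real.pi * (z - n * τ)) := by
    rw [show Real.pi * (z + 1 - n * τ) = Real.pi * (z - n * τ) + Real.pi by ring, Complex.cot,
      Complex.cot, Complex.cos_add_pi, Complex.sin_add_pi, neg_div_neg_eq]
  rw [this]
  ring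

lemma hasSum_eta1 {τ : ℂ} (hτ : 0 < τ.im) :
    HasSum (fun n : ℤ ↦ ∑' m : ℤ, 1 / ((n : ℂ) * τ + m) ^ 2) (eta1 τ) := by
  have hmem : (-(1 / 2) : ℂ) ∉ Lam τ := fun h ↦ half_notMem_Lam hτ <| by
    convert (add_mem_Lam_iff (one_mem_Lam τ)).mpr h using 1
    norm_num
  have h := hasSum_wzeta_add_one_sub_wzeta hτ hmem
  rw [show (-(1 / 2) + 1 : ℂ) = 1 / 2 by norm_num, wzeta_neg, sub_neg_eq_add, ← two_mul] at h
  exact h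

lemma wzeta_add_one {τ : ℂ} (hτ : 0 < τ.im) {z : ℂ} (hz : z ∉ Lam τ) :
    wzeta τ (z + 1) = wzeta τ z + eta1 τ := by
  rw [← sub_eq_iff_eq_add']
  exact (hasSum_wzeta_add_one_sub_wzeta hτ hz).unique (hasSum_eta1 hτ)

lemma wzeta_add_self_sub_wzeta {τ : ℂ} (hτ : 0 < τ.im) {z : ℂ} (hz : z ∉ Lam τ) :
    wzeta τ (z + τ) - wzeta τ z = τ * eta1 τ - 2 * Real.pi * I := by
  have h := (hasSum_wzeta_add_sub_wzeta hτ hz (self_mem_Lam τ)).sub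
    ((hasSum_eta1 hτ).mul_left τ)
  simp only [add_sub_cancel_right] at h
  have h1 := h.comp (Finset.tendsto_Icc_neg (R := ℤ))
  have htel (N : ℕ) : ∑ n ∈ Finset.Icc (-N : ℤ) N,
      (Real.pi * Complex.cot (Real.pi * (z + τ - n * τ))
        - Real.pi * Complex.cot (Real.pi * (z - n * τ)))
      = Real.pi * Complex.cot (Real.pi * (z + τ + N * τ))
        - Real.pi * Complex.cot (Real.pi * (z - N * τ)) := by
    induction N with
    | zero => simp
    | succ N ih =>
      rw [Nat.cast_succ, Finset.sum_Icc_succ_eq_add_endpoints, ih]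
      push_cast
      rw [show z + τ - (N + 1) * τ = z - N * τ by ring,
        show z - -(N + 1 : ℂ) * τ = z + τ + N * τ by ring,
        show z + τ - -(N + 1 : ℂ) * τ = z + τ + (N + 1) * τ by ring]
      ring
  have hN : Tendsto (fun N : ℕ ↦ (N : ℝ) * (Real.pi * τ.im)) atTop atTop :=
    tendsto_natCast_atTop_atTop.atTop_mul_const (by positivity)
  have hup : Tendsto (fun N : ℕ ↦ Complex.cot (Real.pi * (z + τ + N * τ))) atTop (𝓝 (-I)) := by
    refine Complex.tendsto_cot_of_tendsto_im_atTop ?_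
    refine (tendsto_atTop_add_const_left _ (Real.pi * (z + τ).im) hN).congr fun N ↦ ?_
    simp
    ring
  have hdown : Tendsto (fun N : ℕ ↦ Complex.cot (Real.pi * (z - N * τ))) atTop (𝓝 I) := by
    refine Complex.tendsto_cot_of_tendsto_im_atBot ?_
    refine (tendsto_atBot_add_const_left _ (Real.pi * z.im)
      (tendsto_neg_atTop_atBot.comp hN)).congr fun N ↦ ?_
    simp
    ring
  have h2 := (hup.const_mul (Real.pi : ℂ)).sub (hdown.const_mul (Real.pi : ℂ))
  have h3 := tendsto_nhds_unique h1 (h2.congr fun N ↦ (htel N).symm)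
  rw [sub_eq_iff_eq_add] at h3
  rw [h3]
  ring

/-- The Legendre relation. -/
lemma eta2_eq {τ : ℂ} (hτ : 0 < τ.im) : eta2 τ = τ * eta1 τ - 2 * Real.pi * I := by
  have hmem : -(τ / 2) ∉ Lam τ := fun h ↦ self_div_two_notMem_Lam hτ <| by
    convert (add_mem_Lam_iff (self_mem_Lam τ)).mpr h using 1
    ring
  have h := wzeta_add_self_sub_wzeta hτ hmem
  rw [show -(τ / 2) + τ = τ / 2 by ring, wzeta_neg, sub_neg_eq_add, ← two_mul] at h
  exact h

lemma wzeta_add_self {τ : ℂ} (hτ : 0 < τ.im) {z : ℂ} (hz : z ∉ Lam τ) :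
    wzeta τ (z + τ) = wzeta τ z + eta2 τ := by
  rw [← sub_eq_iff_eq_add', eta2_eq hτ]
  exact wzeta_add_self_sub_wzeta hτ hz

lemma norm_primaryFactor_sub_one_le {u : ℂ} (hu : ‖u‖ ≤ 1 / 2) :
    ‖(1 - u) * Complex.exp (u + u ^ 2 / 2) - 1‖ ≤ 2 * ‖u‖ ^ 3 := by
  have hu1 : ‖-u‖ < 1 := by rw [norm_neg]; linarith
  have h := Complex.norm_log_sub_logTaylor_le 2 hu1
  have hT : Complex.logTaylor (2 + 1) (-u) = -(u + u ^ 2 / 2) := by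
    simp [Complex.logTaylor, Finset.sum_range_succ]
    ring
  rw [hT, sub_neg_eq_add, norm_neg, ← sub_eq_add_neg] at h
  have hinv : (1 - ‖u‖)⁻¹ ≤ 2 := by
    rw [inv_le_comm₀ (by linarith) two_pos]
    linarith
  have h1 : ‖Complex.log (1 - u) + (u + u ^ 2 / 2)‖ ≤ ‖u‖ ^ 3 := by
    refine h.trans ?_
    calc ‖u‖ ^ (2 + 1) * (1 - ‖u‖)⁻¹ / ((2 : ℕ) + 1) ≤ ‖u‖ ^ (2 + 1) * 2 / ((2 : ℕ) + 1) := by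
          gcongr
      _ ≤ ‖u‖ ^ 3 := by push_cast; linarith [pow_nonneg (norm_nonneg u) 3]
  have h2 : ‖u‖ ^ 3 ≤ 1 := pow_le_one₀ (norm_nonneg u) (by linarith)
  have hne : 1 - u ≠ 0 := fun h0 ↦ by
    rw [← sub_eq_zero.mp h0] at hu
    norm_num at hu
  have h3 := Complex.norm_exp_sub_one_le (h1.trans h2)
  rw [Complex.exp_add, Complex.exp_log hne] at h3
  linarith

/-- The Weierstrass factor of `σ` at the lattice point `ω`. -/
def sigmaFactor (ω z : ℂ) : ℂ := (1 - z / ω) * Complex.exp (z / ω + z ^ 2 / (2 * ω ^ 2))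

lemma differentiable_sigmaFactor (ω : ℂ) : Differentiable ℂ (sigmaFactor ω) := by
  unfold sigmaFactor
  fun_prop

lemma sigmaFactor_ne_zero {ω z : ℂ} (hω : ω ≠ 0) (hz : z ≠ ω) : sigmaFactor ω z ≠ 0 := by
  refine mul_ne_zero (fun h ↦ hz ?_) (Complex.exp_ne_zero _)
  rw [sub_eq_zero, eq_div_iff hω, one_mul] at h
  exact h.symm

lemma logDeriv_sigmaFactor {ω z : ℂ} (hω : ω ≠ 0) (hz : z ≠ ω) :
    logDeriv (sigmaFactor ω) z = 1 / (z - ω) + 1 / ω + z / ω ^ 2 := by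
  have h1 : HasDerivAt (fun z ↦ 1 - z / ω) (-(1 / ω)) z :=
    ((hasDerivAt_id z).div_const ω).const_sub 1
  have h2 : HasDerivAt (fun z ↦ z / ω + z ^ 2 / (2 * ω ^ 2)) (1 / ω + z / ω ^ 2) z := by
    refine (((hasDerivAt_id z).div_const ω).add
      ((hasDerivAt_pow 2 z).div_const (2 * ω ^ 2))).congr_deriv ?_
    simp
    field_simp
  have h3 := (h1.mul h2.cexp).deriv
  have hzω : z - ω ≠ 0 := sub_ne_zero.mpr hz
  have hωz : ω - z ≠ 0 := sub_ne_zero.mpr hz.symm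
  rw [logDeriv_apply, sigmaFactor, show sigmaFactor ω = (fun z ↦ 1 - z / ω) *
    fun z ↦ Complex.exp (z / ω + z ^ 2 / (2 * ω ^ 2)) from rfl, h3, div_eq_iff]
  · have : 1 - z / ω = (ω - z) / ω := by field_simp
    rw [this]
    rw [show z - ω = -(ω - z) by ring]
    field_simp
    ring
  · exact sigmaFactor_ne_zero hω hz

lemma summable_norm_inv_Lam' {τ : ℂ} (hτ : 0 < τ.im) :
    Summable fun ω : Lam' τ ↦ ‖(ω : ℂ)⁻¹‖ ^ 3 := by
  rw [← (latticePointEquiv hτ).summable_iff]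
  exact (summable_norm_latticePoint_inv hτ).comp_injective Subtype.val_injective

lemma eventually_cofinite_le_norm_Lam' {τ : ℂ} (hτ : 0 < τ.im) (R : ℝ) :
    ∀ᶠ ω : Lam' τ in cofinite, R ≤ ‖(ω : ℂ)‖ := by
  have h := (Subtype.val_injective.comp (latticePointEquiv hτ).symm.injective).tendsto_cofinite
    (eventually_cofinite_le_norm_latticePoint hτ R)
  filter_upwards [h] with ω hω
  rw [← (latticePointEquiv hτ).apply_symm_apply ω]
  exact hω

lemma eventually_norm_sigmaFactor_sub_one_le {τ : ℂ} (hτ : 0 < τ.im) (r : ℝ) :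
    ∀ᶠ ω : Lam' τ in cofinite, ∀ z ∈ Metric.ball (0 : ℂ) r,
      ‖sigmaFactor ω z - 1‖ ≤ 2 * r ^ 3 * ‖(ω : ℂ)⁻¹‖ ^ 3 := by
  filter_upwards [eventually_cofinite_le_norm_Lam' hτ (2 * r)] with ω hω z hz
  have hz : ‖z‖ < r := by simpa using hz
  have hω0 : 0 < ‖(ω : ℂ)‖ := by linarith [norm_nonneg z]
  have hu : ‖z / ω‖ ≤ 1 / 2 := by
    rw [norm_div, div_le_iff₀ hω0]
    linarith
  have h := norm_primaryFactor_sub_one_le hu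
  have he : sigmaFactor ω z = (1 - z / ω) * Complex.exp (z / ω + (z / ω) ^ 2 / 2) := by
    rw [sigmaFactor, div_pow, div_div, mul_comm (2 : ℂ)]
  rw [he]
  refine h.trans ?_
  rw [div_eq_mul_inv, norm_mul, mul_pow, mul_assoc]
  gcongr

lemma multipliableLocallyUniformlyOn_sigmaFactor {τ : ℂ} (hτ : 0 < τ.im) (r : ℝ) :
    MultipliableLocallyUniformlyOn (fun ω : Lam' τ ↦ sigmaFactor ω) (Metric.ball (0 : ℂ) r) := by
  have h := Summable.multipliableLocallyUniformlyOn_one_add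
    (f := fun (ω : Lam' τ) z ↦ sigmaFactor ω z - 1) Metric.isOpen_ball
    ((summable_norm_inv_Lam' hτ).mul_left (2 * r ^ 3))
    (eventually_norm_sigmaFactor_sub_one_le hτ r)
    (fun ω ↦ ((differentiable_sigmaFactor ω).continuous.sub continuous_const).continuousOn)
  simpa using h

lemma differentiable_tprod_sigmaFactor {τ : ℂ} (hτ : 0 < τ.im) :
    Differentiable ℂ fun z ↦ ∏' ω : Lam' τ, sigmaFactor ω z := by
  intro z
  have h := (multipliableLocallyUniformlyOn_sigmaFactor hτ (‖z‖ + 1)).hasProdLocallyUniformlyOn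
  refine DifferentiableOn.differentiableAt (h.differentiableOn (.of_forall fun s ↦ ?_)
    Metric.isOpen_ball) (Metric.isOpen_ball.mem_nhds (by simp))
  exact DifferentiableOn.fun_finsetProd fun ω _ ↦ (differentiable_sigmaFactor ω).differentiableOn

lemma differentiable_wsigma {τ : ℂ} (hτ : 0 < τ.im) : Differentiable ℂ (wsigma τ) :=
  differentiable_id.mul (differentiable_tprod_sigmaFactor hτ)

lemma ne_of_notMem_Lam {τ z : ℂ} (hz : z ∉ Lam τ) (ω : Lam' τ) : z ≠ ω :=
  fun h ↦ hz (h ▸ ω.2.1)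

lemma tprod_sigmaFactor_ne_zero {τ : ℂ} (hτ : 0 < τ.im) {z : ℂ} (hz : z ∉ Lam τ) :
    ∏' ω : Lam' τ, sigmaFactor ω z ≠ 0 := by
  have h := tprod_one_add_ne_zero_of_summable (f := fun ω : Lam' τ ↦ sigmaFactor ω z - 1)
    (fun ω ↦ by simpa using sigmaFactor_ne_zero ω.2.2 (ne_of_notMem_Lam hz ω)) <| by
    refine .of_norm_bounded_eventually
      ((summable_norm_inv_Lam' hτ).mul_left (2 * (‖z‖ + 1) ^ 3)) ?_
    filter_upwards [eventually_norm_sigmaFactor_sub_one_le hτ (‖z‖ + 1)] with ω hω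
    simpa using hω z (by simp)
  simpa using h

lemma ne_zero_of_notMem_Lam {τ z : ℂ} (hz : z ∉ Lam τ) : z ≠ 0 :=
  fun h ↦ hz ⟨0, 0, by simp [h]⟩

lemma wsigma_ne_zero {τ : ℂ} (hτ : 0 < τ.im) {z : ℂ} (hz : z ∉ Lam τ) : wsigma τ z ≠ 0 :=
  mul_ne_zero (ne_zero_of_notMem_Lam hz) (tprod_sigmaFactor_ne_zero hτ hz)

lemma logDeriv_wsigma {τ : ℂ} (hτ : 0 < τ.im) {z : ℂ} (hz : z ∉ Lam τ) :
    logDeriv (wsigma τ) z = wzeta τ z := by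
  have hlog (ω : Lam' τ) := logDeriv_sigmaFactor ω.2.2 (ne_of_notMem_Lam hz ω)
  have hsum : Summable fun ω : Lam' τ ↦ logDeriv (sigmaFactor ω) z := by
    simp only [hlog]
    rw [← (latticePointEquiv hτ).summable_iff]
    exact (summable_zeta_term hτ z).comp_injective Subtype.val_injective
  have h := logDeriv_tprod_eq_tsum Metric.isOpen_ball
    (show z ∈ Metric.ball (0 : ℂ) (‖z‖ + 1) by simp)
    (fun ω : Lam' τ ↦ sigmaFactor_ne_zero ω.2.2 (ne_of_notMem_Lam hz ω))
    (fun ω ↦ (differentiable_sigmaFactor ω).differentiableOn) hsum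
    (multipliableLocallyUniformlyOn_sigmaFactor hτ _) (tprod_sigmaFactor_ne_zero hτ hz)
  have hmul := logDeriv_mul z (f := id) (ne_zero_of_notMem_Lam hz)
    (tprod_sigmaFactor_ne_zero hτ hz) differentiableAt_id
    (differentiable_tprod_sigmaFactor hτ z)
  rw [h, logDeriv_id, tsum_congr hlog] at hmul
  exact hmul

/-- If `ζ(z + w) = ζ(z) + η` off the lattice, then `σ(z + w) = c e^{ηz} σ(z)` for a nonzero
constant `c`. -/
lemma exists_wsigma_add_eq {τ : ℂ} (hτ : 0 < τ.im) {w η : ℂ} (hw : w ∈ Lam τ)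
    (hη : ∀ z ∉ Lam τ, wzeta τ (z + w) = wzeta τ z + η) :
    ∃ c ≠ 0, ∀ z ∉ Lam τ, wsigma τ (z + w) = c * (Complex.exp (η * z) * wsigma τ z) := by
  have hσ := differentiable_wsigma hτ
  have hdf : Differentiable ℂ fun z ↦ wsigma τ (z + w) := hσ.comp (by fun_prop)
  have hde : Differentiable ℂ fun z ↦ Complex.exp (η * z) := by fun_prop
  obtain ⟨c, hc, h⟩ := (logDeriv_eqOn_iff hdf.differentiableOn (hde.mul hσ).differentiableOn
    (isOpen_compl_Lam hτ) (isPreconnected_compl_Lam τ)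
    (fun z hz ↦ mul_ne_zero (Complex.exp_ne_zero _) (wsigma_ne_zero hτ hz))
    (fun z hz ↦ wsigma_ne_zero hτ ((add_mem_Lam_iff hw).not.mpr hz))).mp <| by
      intro z hz
      have h1 : logDeriv (fun z ↦ wsigma τ (z + w)) z = logDeriv (wsigma τ) (z + w) := by
        rw [logDeriv_apply, logDeriv_apply, deriv_comp_add_const]
      have h2 : logDeriv (fun z ↦ Complex.exp (η * z)) z = η := by
        have := ((hasDerivAt_id z).const_mul η).cexp.deriv
        simp only [id, mul_one] at this
        rw [logDeriv_apply, this, mul_div_cancel_left₀ _ (Complex.exp_ne_zero _)]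
      have h3 : logDeriv ((fun z ↦ Complex.exp (η * z)) * wsigma τ) z = η + wzeta τ z := by
        have := logDeriv_mul z (f := fun z ↦ Complex.exp (η * z)) (Complex.exp_ne_zero _)
          (wsigma_ne_zero hτ hz) (hde z) (hσ z)
        rw [h2, logDeriv_wsigma hτ hz] at this
        exact this
      rw [h3, h1, logDeriv_wsigma hτ ((add_mem_Lam_iff hw).not.mpr hz), hη z hz, add_comm]
  exact ⟨c, hc, fun z hz ↦ h hz⟩

lemma fdev_add {τ : ℂ} (hτ : 0 < τ.im) {w η : ℂ} (hw : w ∈ Lam τ)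
    (hη : ∀ z ∉ Lam τ, wzeta τ (z + w) = wzeta τ z + η) {a z : ℂ} (hza : z - a ∉ Lam τ)
    (hza' : z + a ∉ Lam τ) :
    fdev τ a (z + w) = Complex.exp (4 * (wzeta τ a * w - η * a)) * fdev τ a z := by
  obtain ⟨c, hc, h⟩ := exists_wsigma_add_eq hτ hw hη
  have hσ := wsigma_ne_zero hτ hza'
  rw [fdev, fdev, show z + w - a = z - a + w by ring, show z + w + a = z + a + w by ring,
    h _ hza, h _ hza']
  have he : Complex.exp (4 * wzeta τ a * (z + w)) * Complex.exp (η * (z - a)) ^ 2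
      = Complex.exp (4 * (wzeta τ a * w - η * a)) * Complex.exp (4 * wzeta τ a * z)
        * Complex.exp (η * (z + a)) ^ 2 := by
    simp only [← Complex.exp_nat_mul, ← Complex.exp_add]
    congr 1
    push_cast
    ring
  have hne := Complex.exp_ne_zero (η * (z + a))
  rw [mul_pow, mul_pow, mul_pow, mul_pow, ← mul_div_assoc, div_eq_div_iff (by positivity)
    (by positivity)]
  linear_combination c ^ 2 * wsigma τ (z - a) ^ 2 * wsigma τ (z + a) ^ 2 * he

/-- if `a = r + sτ` is a critical point of the Green function
(`ζ(a) = rη₁ + sη₂`), then `f` is a type II developing map with monodromy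
data `(2r, 2s)`. -/
theorem stmt_13 (τ r s : ℂ) (hτ : 0 < τ.im)
    (h2a : 2 * (r + s * τ) ∉ Lam τ)
    (hZ : wzeta τ (r + s * τ) = r * eta1 τ + s * eta2 τ) :
    ∀ z : ℂ, z - (r + s * τ) ∉ Lam τ → z + (r + s * τ) ∉ Lam τ →
      fdev τ (r + s * τ) (z + 1)
          = Complex.exp (-(4 * Real.pi * Complex.I) * (2 * s)) * fdev τ (r + s * τ) z ∧
        fdev τ (r + s * τ) (z + τ)
          = Complex.exp (4 * Real.pi * Complex.I * (2 * r)) * fdev τ (r + s * τ) z := by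
  intro z hz hz'
  rw [fdev_add hτ (one_mem_Lam τ) (fun _ ↦ wzeta_add_one hτ) hz hz',
    fdev_add hτ (self_mem_Lam τ) (fun _ ↦ wzeta_add_self hτ) hz hz', hZ, eta2_eq hτ]
  constructor <;> congr 2 <;> ring
end
end
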